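/- Let k be a field of prime characteristic p and let d ≥ 2 be an integer. Then there exists a nonzero homogeneous polynomial f ∈ k[x,y,z,w] of degree d such that the sequence (dim_k k[x,y,z,w]/(f, x^{pⁿ}, y^{pⁿ}, z^{pⁿ}, w^{pⁿ}))/p^{3n} converges to 2d/3 as n → ∞; that is, there is a surface of degree d in P³ whose Hilbert-Kunz multiplicity equals 2d/3, the minimal possible value for surfaces of degree d. -/

import Mathlib

open MvPolynomial

section Colength

variable {k S : Type*} [Field k] [CommRing S] [Algebra k S]

theorem Ideal.finite_quotient_of_le {I J : Ideal S} (h : I ≤ J) [Module.Finite k (S ⧸ I)] :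
    Module.Finite k (S ⧸ J) :=
  Module.Finite.of_surjective (Ideal.Quotient.factorₐ k h).toLinearMap
    (Ideal.Quotient.factor_surjective h)

theorem Ideal.finrank_quotient_le_of_le {I J : Ideal S} (h : I ≤ J) [Module.Finite k (S ⧸ I)] :
    Module.finrank k (S ⧸ J) ≤ Module.finrank k (S ⧸ I) :=
  LinearMap.finrank_le_finrank_of_surjective (f := (Ideal.Quotient.factorₐ k h).toLinearMap)
    (Ideal.Quotient.factor_surjective h)

/-- Multiplication by `f` from `S ⧸ P` to `S ⧸ Q`. -/
noncomputable def Ideal.quotientMul (k : Type*) {S : Type*} [Field k] [CommRing S] [Algebra k S]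
    (f : S) (P Q : Ideal S) (h : ∀ u ∈ P, f * u ∈ Q) :
    (S ⧸ P) →ₗ[k] (S ⧸ Q) :=
  (Submodule.mapQ P Q (LinearMap.mulLeft S f) h).restrictScalars k

theorem Ideal.finrank_quotient_eq_add_finrank_range (f : S) (P Q : Ideal S)
    (h : ∀ u ∈ P, f * u ∈ Q) [Module.Finite k (S ⧸ Q)] :
    Module.finrank k (S ⧸ Q) = Module.finrank k (S ⧸ (Ideal.span {f} ⊔ Q)) +
      Module.finrank k (LinearMap.range (Ideal.quotientMul k f P Q h)) := by
  have hle : Q ≤ Ideal.span {f} ⊔ Q := le_sup_right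
  have hker : LinearMap.ker (Ideal.Quotient.factorₐ k hle).toLinearMap =
      LinearMap.range (Ideal.quotientMul k f P Q h) := by
    ext u
    obtain ⟨u, rfl⟩ := Ideal.Quotient.mk_surjective u
    constructor
    · intro hu
      have hu : u ∈ Ideal.span {f} ⊔ Q := Ideal.Quotient.eq_zero_iff_mem.1 (by simpa using hu)
      obtain ⟨v, b, hb, rfl⟩ := Ideal.mem_span_singleton_sup.1 hu
      refine ⟨Ideal.Quotient.mk P v, ?_⟩
      refine (Ideal.Quotient.mk_eq_mk_iff_sub_mem (I := Q) _ _).2 ?_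
      simpa [mul_comm] using hb
    · rintro ⟨v, hv⟩
      obtain ⟨v, rfl⟩ := Ideal.Quotient.mk_surjective v
      rw [← hv]
      exact Ideal.Quotient.eq_zero_iff_mem.2
        (Ideal.mem_sup_left (Ideal.mul_mem_right _ _ (Ideal.mem_span_singleton_self f)))
  have hrange : LinearMap.range (Ideal.Quotient.factorₐ k hle).toLinearMap = ⊤ :=
    LinearMap.range_eq_top.2 (Ideal.Quotient.factor_surjective hle)
  have := LinearMap.finrank_range_add_finrank_ker (Ideal.Quotient.factorₐ k hle).toLinearMap
  rw [hrange, finrank_top, hker] at this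
  exact this.symm

theorem Ideal.finrank_quotient_le_add (f : S) {P Q : Ideal S} (h : ∀ u ∈ P, f * u ∈ Q)
    [Module.Finite k (S ⧸ P)] [Module.Finite k (S ⧸ Q)] :
    Module.finrank k (S ⧸ Q) ≤
      Module.finrank k (S ⧸ (Ideal.span {f} ⊔ Q)) + Module.finrank k (S ⧸ P) := by
  rw [Ideal.finrank_quotient_eq_add_finrank_range f P Q h]
  gcongr
  exact LinearMap.finrank_range_le _

theorem Ideal.finrank_quotient_eq_add (f : S) {P Q : Ideal S} (h : ∀ u, f * u ∈ Q ↔ u ∈ P)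
    [Module.Finite k (S ⧸ Q)] :
    Module.finrank k (S ⧸ Q) =
      Module.finrank k (S ⧸ (Ideal.span {f} ⊔ Q)) + Module.finrank k (S ⧸ P) := by
  rw [Ideal.finrank_quotient_eq_add_finrank_range f P Q fun u => (h u).2]
  congr 1
  refine LinearMap.finrank_range_of_inj ((injective_iff_map_eq_zero _).2 fun u hu => ?_)
  obtain ⟨u, rfl⟩ := Ideal.Quotient.mk_surjective u
  exact Ideal.Quotient.eq_zero_iff_mem.2 ((h u).1 (Ideal.Quotient.eq_zero_iff_mem.1 hu))

/-- Colengths are subadditive in products of equations. -/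
theorem Ideal.finrank_quotient_mul_sup_le (f g : S) (J : Ideal S) [Module.Finite k (S ⧸ J)] :
    Module.finrank k (S ⧸ (Ideal.span {f * g} ⊔ J)) ≤
      Module.finrank k (S ⧸ (Ideal.span {f} ⊔ J)) +
        Module.finrank k (S ⧸ (Ideal.span {g} ⊔ J)) := by
  have := Ideal.finite_quotient_of_le (k := k) (le_sup_right : J ≤ Ideal.span {g} ⊔ J)
  have := Ideal.finite_quotient_of_le (k := k) (le_sup_right : J ≤ Ideal.span {f * g} ⊔ J)
  have key := Ideal.finrank_quotient_le_add (k := k) f (P := Ideal.span {g} ⊔ J)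
    (Q := Ideal.span {f * g} ⊔ J) fun u hu => by
      obtain ⟨v, b, hb, rfl⟩ := Ideal.mem_span_singleton_sup.1 hu
      rw [mul_add]
      exact add_mem (Ideal.mem_sup_left (Ideal.mem_span_singleton'.2 ⟨v, by ring⟩))
        (Ideal.mem_sup_right (J.mul_mem_left _ hb))
  rwa [← sup_assoc, sup_of_le_left
    (Ideal.span_singleton_le_span_singleton.2 (Dvd.intro g rfl) :
      Ideal.span {f * g} ≤ Ideal.span {f})] at key

theorem Ideal.finrank_quotient_pow_sup_le (f : S) (J : Ideal S) [Module.Finite k (S ⧸ J)] (m : ℕ) :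
    Module.finrank k (S ⧸ (Ideal.span {f ^ m} ⊔ J)) ≤
      m * Module.finrank k (S ⧸ (Ideal.span {f} ⊔ J)) := by
  induction m with
  | zero =>
    have : Ideal.span {f ^ 0} ⊔ J = ⊤ := by simp
    rw [this, zero_mul, nonpos_iff_eq_zero]
    exact Module.finrank_zero_of_subsingleton
  | succ m ih =>
    rw [pow_succ, add_one_mul]
    exact (Ideal.finrank_quotient_mul_sup_le _ _ _).trans (by gcongr)

end Colength


section MonomialIdeal

variable {σ k : Type*} [Field k]

theorem mem_restrictSupportIdeal_iff_coeff {R : Type*} [CommSemiring R] {D : Set (σ →₀ ℕ)}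
    (hD : IsUpperSet D) {f : MvPolynomial σ R} :
    f ∈ restrictSupportIdeal R D hD ↔ ∀ a, a ∉ D → coeff a f = 0 := by
  change f ∈ restrictSupport R D ↔ _
  rw [mem_restrictSupport_iff]
  constructor
  · intro h a ha
    by_contra hc
    exact ha (h (by simpa using hc))
  · intro h a ha
    by_contra hc
    simp only [SetLike.mem_coe, mem_support_iff] at ha
    exact ha (h a hc)

theorem restrictSupportIdeal_le {R : Type*} [CommSemiring R] {D : Set (σ →₀ ℕ)} {hD : IsUpperSet D}
    {I : Ideal (MvPolynomial σ R)} (h : ∀ a ∈ D, monomial a 1 ∈ I) :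
    restrictSupportIdeal R D hD ≤ I := by
  intro f hf
  rw [as_sum f]
  refine I.sum_mem fun a ha => ?_
  have ha : a ∈ D := by
    by_contra hc
    exact (mem_support_iff.1 ha) ((mem_restrictSupportIdeal_iff_coeff hD).1 hf a hc)
  simpa [C_mul_monomial] using I.mul_mem_left (C (coeff a f)) (h a ha)

/-- The quotient by the monomial ideal with exponents in `D` has the monomials with exponents
outside `D` as a basis. -/
noncomputable def quotientRestrictSupportIdealEquiv (k : Type*) [Field k] {D : Set (σ →₀ ℕ)}
    (hD : IsUpperSet D) :
    (MvPolynomial σ k ⧸ restrictSupportIdeal k D hD) ≃ₗ[k] ((Dᶜ : Set (σ →₀ ℕ)) →₀ k) := by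
  classical
  refine (Submodule.Quotient.restrictScalarsEquiv k (restrictSupportIdeal (R := k) D hD)).symm ≪≫ₗ
    Submodule.quotEquivOfEq _ _ ?_ ≪≫ₗ
      LinearMap.quotKerEquivOfSurjective
        (Finsupp.lsubtypeDomain (Dᶜ) ∘ₗ
          (AddMonoidAlgebra.coeffLinearEquiv k).toLinearMap) ?_
  · ext f
    rw [Submodule.restrictScalars_mem, mem_restrictSupportIdeal_iff_coeff, LinearMap.mem_ker,
      Finsupp.ext_iff]
    exact ⟨fun h a => h a a.2, fun h a ha => h ⟨a, ha⟩⟩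
  · rw [LinearMap.coe_comp]
    refine Function.Surjective.comp (fun g => ⟨g.extendDomain, ?_⟩) (LinearEquiv.surjective _)
    exact Finsupp.subtypeDomain_extendDomain g

theorem finite_quotient_restrictSupportIdeal {D : Set (σ →₀ ℕ)} (hD : IsUpperSet D)
    (h : Dᶜ.Finite) : Module.Finite k (MvPolynomial σ k ⧸ restrictSupportIdeal k D hD) := by
  have := h.to_subtype
  exact Module.Finite.equiv (quotientRestrictSupportIdealEquiv k hD).symm

theorem finrank_quotient_restrictSupportIdeal {D : Set (σ →₀ ℕ)} (hD : IsUpperSet D)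
    (h : Dᶜ.Finite) :
    Module.finrank k (MvPolynomial σ k ⧸ restrictSupportIdeal k D hD) = Dᶜ.ncard := by
  have := h.fintype
  rw [(quotientRestrictSupportIdealEquiv k hD).finrank_eq, Module.finrank_finsupp_self,
    Set.ncard_eq_toFinset_card', Set.toFinset_card]

end MonomialIdeal

section Truncation

variable {k : Type*} [Field k]

/-- The exponents of degree at least `n`, together with those having an entry at least `q`. -/
def truncExponents (q n : ℕ) : Set (Fin 4 →₀ ℕ) := {a | n ≤ a.degree ∨ ∃ i, q ≤ a i}

theorem isUpperSet_truncExponents (q n : ℕ) : IsUpperSet (truncExponents q n) := by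
  rintro a b hab (h | ⟨i, hi⟩)
  · exact Or.inl (h.trans (Finsupp.degree_mono hab))
  · exact Or.inr ⟨i, hi.trans (hab i)⟩

theorem finite_compl_truncExponents (q n : ℕ) : (truncExponents q n)ᶜ.Finite := by
  refine (Set.finite_Iic (Finsupp.equivFunOnFinite.symm fun _ => q)).subset fun a ha i => ?_
  by_contra hc
  exact ha (Or.inr ⟨i, (not_le.1 hc).le⟩)

/-- The ideal `(x ^ q, y ^ q, z ^ q, w ^ q) + (x, y, z, w) ^ n`. -/
noncomputable def truncIdeal (k : Type*) [Field k] (q n : ℕ) : Ideal (MvPolynomial (Fin 4) k) :=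
  restrictSupportIdeal k (truncExponents q n) (isUpperSet_truncExponents q n)

/-- The ideal `(x ^ q, y ^ q, z ^ q, w ^ q)`. -/
noncomputable def powIdeal (k : Type*) [Field k] (q : ℕ) : Ideal (MvPolynomial (Fin 4) k) :=
  Ideal.span {X 0 ^ q, X 1 ^ q, X 2 ^ q, X 3 ^ q}

theorem mem_truncIdeal {q n : ℕ} {f : MvPolynomial (Fin 4) k} :
    f ∈ truncIdeal k q n ↔ ∀ a : Fin 4 →₀ ℕ, a.degree < n → (∀ i, a i < q) → coeff a f = 0 := by
  rw [truncIdeal, mem_restrictSupportIdeal_iff_coeff]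
  simp [truncExponents]

instance (q n : ℕ) : Module.Finite k (MvPolynomial (Fin 4) k ⧸ truncIdeal k q n) :=
  finite_quotient_restrictSupportIdeal _ (finite_compl_truncExponents q n)

theorem X_pow_mem_powIdeal (q : ℕ) (i : Fin 4) :
    (X i ^ q : MvPolynomial (Fin 4) k) ∈ powIdeal k q := by
  apply Ideal.subset_span
  fin_cases i <;> simp

theorem powIdeal_le {q : ℕ} {I : Ideal (MvPolynomial (Fin 4) k)} (h : ∀ i, X i ^ q ∈ I) :
    powIdeal k q ≤ I := by
  rw [powIdeal, Ideal.span_le]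
  rintro _ (rfl | rfl | rfl | rfl) <;> exact h _

theorem powIdeal_le_truncIdeal (q n : ℕ) : powIdeal k q ≤ truncIdeal k q n := by
  refine powIdeal_le fun i => mem_truncIdeal.2 fun a _ ha => ?_
  rw [coeff_X_pow, if_neg]
  rintro rfl
  simpa using ha i

theorem monomial_mem_of_le {σ R : Type*} [CommSemiring R] {I : Ideal (MvPolynomial σ R)}
    {a b : σ →₀ ℕ} (h : b ≤ a) (hb : monomial b 1 ∈ I) : monomial a 1 ∈ I := by
  obtain ⟨c, rfl⟩ := exists_add_of_le h
  rw [← one_mul (1 : R), ← monomial_mul]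
  exact I.mul_mem_right _ hb

theorem truncIdeal_le {q n : ℕ} {I : Ideal (MvPolynomial (Fin 4) k)} (h : ∀ i, X i ^ q ∈ I)
    (hn : ∀ a : Fin 4 →₀ ℕ, a.degree = n → monomial a 1 ∈ I) : truncIdeal k q n ≤ I := by
  refine restrictSupportIdeal_le ?_
  rintro a (ha | ⟨i, hi⟩)
  · obtain ⟨b, hb, rfl⟩ := a.exists_le_degree_eq _ ha
    exact monomial_mem_of_le hb (hn b rfl)
  · refine monomial_mem_of_le (b := Finsupp.single i q) (by simpa using hi) ?_
    rw [← X_pow_eq_monomial]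
    exact h i

theorem truncIdeal_eq_powIdeal (q : ℕ) : truncIdeal k q (4 * q) = powIdeal k q := by
  refine (truncIdeal_le (X_pow_mem_powIdeal q) fun a ha => ?_).antisymm (powIdeal_le_truncIdeal _ _)
  obtain ⟨i, hi⟩ : ∃ i, q ≤ a i := by
    by_contra! hc
    rw [Finsupp.degree_eq_sum, Fin.sum_univ_four] at ha
    have := hc 0; have := hc 1; have := hc 2; have := hc 3
    omega
  refine monomial_mem_of_le (b := Finsupp.single i q) (by simpa using hi) ?_
  rw [← X_pow_eq_monomial]
  exact X_pow_mem_powIdeal q i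

instance (q : ℕ) : Module.Finite k (MvPolynomial (Fin 4) k ⧸ powIdeal k q) := by
  rw [← truncIdeal_eq_powIdeal]
  infer_instance

theorem MvPolynomial.IsHomogeneous.mul_mem_truncIdeal {f u : MvPolynomial (Fin 4) k} {d q m n : ℕ}
    (hf : f.IsHomogeneous d) (hu : u ∈ truncIdeal k q m) (hn : n ≤ d + m) :
    f * u ∈ truncIdeal k q n := by
  rw [mem_truncIdeal] at hu ⊢
  intro a ha hq
  rw [coeff_mul]
  refine Finset.sum_eq_zero ?_
  rintro ⟨b, c⟩ hbc
  obtain rfl : b + c = a := by simpa using hbc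
  by_cases hb : b.degree = d
  · rw [hu c, mul_zero]
    · rw [map_add] at ha
      omega
    · intro i
      exact (Nat.le_add_left _ _).trans_lt (hq i)
  · rw [hf.coeff_eq_zero hb, zero_mul]

/-- The colength of a form of degree `d` is bounded below by the colength it would have if
multiplication by it were injective up to degree `n`. -/
theorem finrank_quotient_truncIdeal_le {f : MvPolynomial (Fin 4) k} {d : ℕ}
    (hf : f.IsHomogeneous d) (q n : ℕ) :
    Module.finrank k (MvPolynomial (Fin 4) k ⧸ truncIdeal k q n) ≤
      Module.finrank k (MvPolynomial (Fin 4) k ⧸ (Ideal.span {f} ⊔ powIdeal k q)) +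
        Module.finrank k (MvPolynomial (Fin 4) k ⧸ truncIdeal k q (n - d)) := by
  refine (Ideal.finrank_quotient_le_add f (P := truncIdeal k q (n - d)) fun u hu =>
    hf.mul_mem_truncIdeal hu (by omega)).trans ?_
  gcongr
  have := Ideal.finite_quotient_of_le (k := k)
    (le_sup_right : powIdeal k q ≤ Ideal.span {f} ⊔ powIdeal k q)
  exact Ideal.finrank_quotient_le_of_le (sup_le_sup_left (powIdeal_le_truncIdeal q n) _)

/-- If the multiples of `f` generate all monomials of degree `n` modulo every ideal containing
`(x ^ q, y ^ q, z ^ q, w ^ q)`, and `n` is at most half of the socle degree, then multiplication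
by `f` is injective up to degree `n`. -/
theorem finrank_quotient_truncIdeal_eq {f : MvPolynomial (Fin 4) k} {d q n : ℕ}
    (hf : f.IsHomogeneous d) (hd : d ≤ n) (hn : 2 * n + 3 ≤ 4 * q + d)
    (h : ∀ I : Ideal (MvPolynomial (Fin 4) k), (∀ i, X i ^ q ∈ I) →
      (∀ b : Fin 4 →₀ ℕ, b.degree + d = n → f * monomial b 1 ∈ I) →
      ∀ a : Fin 4 →₀ ℕ, a.degree = n → monomial a 1 ∈ I) :
    Module.finrank k (MvPolynomial (Fin 4) k ⧸ truncIdeal k q n) =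
      Module.finrank k (MvPolynomial (Fin 4) k ⧸ (Ideal.span {f} ⊔ powIdeal k q)) +
        Module.finrank k (MvPolynomial (Fin 4) k ⧸ truncIdeal k q (n - d)) := by
  have hle : Ideal.span {f} ⊔ truncIdeal k q n = Ideal.span {f} ⊔ powIdeal k q := by
    refine (sup_le le_sup_left (truncIdeal_le ?_ (h _ ?_ ?_))).antisymm
      (sup_le_sup_left (powIdeal_le_truncIdeal q n) _)
    · exact fun i => Ideal.mem_sup_right (X_pow_mem_powIdeal q i)
    · exact fun i => Ideal.mem_sup_right (X_pow_mem_powIdeal q i)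
    · exact fun b _ => Ideal.mem_sup_left
        (Ideal.mul_mem_right _ _ (Ideal.mem_span_singleton_self f))
  rw [← hle]
  refine Ideal.finrank_quotient_eq_add f fun u =>
    ⟨fun hu => mem_truncIdeal.2 fun a ha hq => ?_, fun hu => hf.mul_mem_truncIdeal hu (by omega)⟩
  let s : Fin 4 →₀ ℕ := Finsupp.equivFunOnFinite.symm fun i => q - 1 - a i
  have hs : n ≤ s.degree := by
    rw [Finsupp.degree_eq_sum, Fin.sum_univ_four] at ha ⊢
    simp only [s, Finsupp.coe_equivFunOnFinite_symm]
    have := hq 0; have := hq 1; have := hq 2; have := hq 3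
    omega
  obtain ⟨b, hb, hbn⟩ := s.exists_le_degree_eq _ hs
  have hmem := h (Submodule.comap (LinearMap.mulRight (MvPolynomial (Fin 4) k) u)
    (truncIdeal k q (n + (n - d))))
    (fun i => Ideal.mul_mem_right _ _ (powIdeal_le_truncIdeal _ _ (X_pow_mem_powIdeal q i)))
    (fun c hc => by
      rw [Submodule.mem_comap, LinearMap.mulRight_apply, mul_right_comm, mul_comm]
      exact (isHomogeneous_monomial (d := c) (n := n - d) 1 (by omega)).mul_mem_truncIdeal hu
        (by omega)) b hbn
  have := mem_truncIdeal.1 hmem (b + a) (by rw [map_add]; omega) fun i => by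
    have h1 := hb i
    have h2 := hq i
    simp only [s, Finsupp.coe_equivFunOnFinite_symm, Finsupp.add_apply] at h1 ⊢
    omega
  simpa [coeff_monomial_mul] using this

end Truncation

section Counting

open Finset

/-- The number of quadruples in `{0, …, q - 1}` with sum `j`. -/
def boxCount (q j : ℕ) : ℕ :=
  #{v ∈ range q ×ˢ range q ×ˢ range q ×ˢ range q | v.1 + v.2.1 + v.2.2.1 + v.2.2.2 = j}

theorem boxCount_succ_le (q j : ℕ) : boxCount q (j + 1) ≤ boxCount q j + q ^ 2 := by
  have hsub : {v ∈ range q ×ˢ range q ×ˢ range q ×ˢ range q |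
        v.1 + v.2.1 + v.2.2.1 + v.2.2.2 = j + 1} ⊆
      {v ∈ range q ×ˢ range q ×ˢ range q ×ˢ range q | v.1 + v.2.1 + v.2.2.1 + v.2.2.2 = j}.image
        (fun v => (v.1, v.2.1, v.2.2.1, v.2.2.2 + 1)) ∪
      (range q ×ˢ range q).image (fun v => (v.1, v.2, j + 1 - v.1 - v.2, 0)) := by
    rintro ⟨a, b, c, e⟩ h
    simp only [mem_filter, mem_product, mem_range, mem_union, mem_image, Prod.mk.injEq,
      Prod.exists] at h ⊢
    cases e with
    | zero => exact Or.inr ⟨a, b, by omega⟩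
    | succ e => exact Or.inl ⟨a, b, c, e, by omega⟩
  refine (card_le_card hsub).trans ((card_union_le _ _).trans ?_)
  gcongr
  · exact card_image_le
  · exact card_image_le.trans (by simp [sq])

theorem boxCount_le_succ (q j : ℕ) : boxCount q j ≤ boxCount q (j + 1) + q ^ 2 := by
  have hsub : {v ∈ range q ×ˢ range q ×ˢ range q ×ˢ range q |
        v.1 + v.2.1 + v.2.2.1 + v.2.2.2 = j} ⊆
      {v ∈ range q ×ˢ range q ×ˢ range q ×ˢ range q |
        v.1 + v.2.1 + v.2.2.1 + v.2.2.2 = j + 1}.image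
        (fun v => (v.1, v.2.1, v.2.2.1, v.2.2.2 - 1)) ∪
      (range q ×ˢ range q).image (fun v => (v.1, v.2, j - v.1 - v.2 - (q - 1), q - 1)) := by
    rintro ⟨a, b, c, e⟩ h
    simp only [mem_filter, mem_product, mem_range, mem_union, mem_image, Prod.mk.injEq,
      Prod.exists] at h ⊢
    rcases eq_or_ne e (q - 1) with he | he
    · exact Or.inr ⟨a, b, by omega⟩
    · exact Or.inl ⟨a, b, c, e + 1, by omega⟩
  refine (card_le_card hsub).trans ((card_union_le _ _).trans ?_)
  gcongr
  · exact card_image_le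
  · exact card_image_le.trans (by simp [sq])

theorem boxCount_add_le (q j i : ℕ) : boxCount q (j + i) ≤ boxCount q j + i * q ^ 2 := by
  induction i with
  | zero => simp
  | succ i ih =>
    rw [← add_assoc]
    linarith [boxCount_succ_le q (j + i)]

theorem boxCount_le_add (q j i : ℕ) : boxCount q j ≤ boxCount q (j + i) + i * q ^ 2 := by
  induction i with
  | zero => simp
  | succ i ih =>
    rw [← add_assoc]
    linarith [boxCount_le_succ q (j + i)]

theorem two_mul_sum_range_sub (n : ℕ) : 2 * ∑ i ∈ range n, (n - i) = n * (n + 1) := by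
  induction n with
  | zero => simp
  | succ n ih =>
    rw [sum_range_succ']
    simp only [Nat.add_sub_add_right, Nat.sub_zero]
    linarith

theorem three_mul_sum_dist_add (n : ℕ) :
    3 * ∑ a ∈ range n, ∑ b ∈ range n, Nat.dist a b + n = n ^ 3 := by
  induction n with
  | zero => simp
  | succ n ih =>
    have h1 : ∑ a ∈ range n, Nat.dist a n = ∑ i ∈ range n, (n - i) :=
      sum_congr rfl fun i hi => Nat.dist_eq_sub_of_le (mem_range.1 hi).le
    have h2 : ∑ a ∈ range n, Nat.dist n a = ∑ i ∈ range n, (n - i) :=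
      sum_congr rfl fun i hi => Nat.dist_eq_sub_of_le_right (mem_range.1 hi).le
    simp only [sum_range_succ, sum_add_distrib, h1, h2, Nat.dist_self]
    linarith [two_mul_sum_range_sub n]

theorem boxCount_central_eq_sum {q : ℕ} (hq : 0 < q) :
    boxCount q (2 * q - 2) = ∑ a ∈ range q, ∑ b ∈ range q, (q - Nat.dist a b) := by
  rw [boxCount, card_eq_sum_card_fiberwise (f := fun v => (v.1, v.2.1)) (t := range q ×ˢ range q),
    sum_product]
  · refine sum_congr rfl fun a ha => ?_
    rw [← sum_range_reflect]
    refine sum_congr rfl fun b hb => ?_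
    rw [mem_range] at ha hb
    trans #((Icc (b - a) (q - 1 - (a - b))).image fun c => (a, q - 1 - b, c, q - 1 - a + b - c))
    · congr 1
      ext ⟨a', b', c, e⟩
      simp only [mem_filter, mem_product, mem_range, mem_image, Prod.mk.injEq, mem_Icc]
      constructor
      · intro h
        exact ⟨c, by omega⟩
      · rintro ⟨c, h⟩
        omega
    · rw [card_image_of_injective _ fun c c' h => by
          simp only [Prod.mk.injEq] at h
          exact h.2.2.1, Nat.card_Icc, Nat.dist]
      omega
  · rintro ⟨a, b, c, e⟩ h
    simp only [coe_filter, mem_product, mem_range, Set.mem_ofPred_eq, coe_product, Set.mem_prod,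
      mem_coe] at h ⊢
    omega

theorem three_mul_boxCount_central {q : ℕ} (hq : 0 < q) :
    3 * boxCount q (2 * q - 2) = 2 * q ^ 3 + q := by
  have h : ∑ a ∈ range q, ∑ b ∈ range q, (q - Nat.dist a b) +
      ∑ a ∈ range q, ∑ b ∈ range q, Nat.dist a b = q ^ 3 := by
    rw [← sum_add_distrib]
    trans ∑ a ∈ range q, ∑ b ∈ range q, q
    · refine sum_congr rfl fun a ha => ?_
      rw [← sum_add_distrib]
      refine sum_congr rfl fun b hb => ?_
      rw [mem_range] at ha hb
      rw [Nat.dist]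
      omega
    · simp
      ring
  have := three_mul_sum_dist_add q
  rw [boxCount_central_eq_sum hq]
  linarith

end Counting

/-- A monomial of degree `2q` lies in `I` as soon as `I` contains `x ^ q` and the
multiples of `xyz + xyw + xzw + yzw` of degree `2q`, provided the exponent of `x` is large enough. -/
theorem cayley_monomial_mem_of_le_add {R : Type*} [CommRing R] {I : Ideal R} {q : ℕ} {x y z w : R}
    (hx : x ^ q ∈ I)
    (hf : ∀ a b c e, a + b + c + e + 3 = 2 * q →
      (x * y * z + x * y * w + x * z * w + y * z * w) * (x ^ a * y ^ b * z ^ c * w ^ e) ∈ I)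
    {a b c e : ℕ} (hs : a + b + c + e = 2 * q)
    (hb : q ≤ a + b) (hc : q ≤ a + c) (he : q ≤ a + e) :
    x ^ a * y ^ b * z ^ c * w ^ e ∈ I := by
  obtain ⟨m, hm⟩ : ∃ m, q ≤ a + m := ⟨q, by omega⟩
  induction m generalizing a b c e with
  | zero =>
    obtain ⟨a, rfl⟩ := Nat.exists_eq_add_of_le hm
    have := I.mul_mem_left (x ^ a * y ^ b * z ^ c * w ^ e) hx
    convert this using 1
    ring
  | succ m ih =>
    rcases le_or_gt q a with h | h
    · exact ih hs hb hc he (by omega)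
    obtain ⟨b, rfl⟩ : ∃ b', b = b' + 1 := ⟨b - 1, by omega⟩
    obtain ⟨c, rfl⟩ : ∃ c', c = c' + 1 := ⟨c - 1, by omega⟩
    obtain ⟨e, rfl⟩ : ∃ e', e = e' + 1 := ⟨e - 1, by omega⟩
    have h0 := hf a b c e (by omega)
    have h1 := @ih (a + 1) b (c + 1) (e + 1) (by omega) (by omega) (by omega) (by omega) (by omega)
    have h2 := @ih (a + 1) (b + 1) c (e + 1) (by omega) (by omega) (by omega) (by omega) (by omega)
    have h3 := @ih (a + 1) (b + 1) (c + 1) e (by omega) (by omega) (by omega) (by omega) (by omega)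
    convert I.sub_mem (I.sub_mem (I.sub_mem h0 h1) h2) h3 using 1
    ring

theorem cayley_monomial_mem_of_add_eq {R : Type*} [CommRing R] {I : Ideal R} {q : ℕ} {x y z w : R}
    (hx : x ^ q ∈ I) (hy : y ^ q ∈ I) (hz : z ^ q ∈ I) (hw : w ^ q ∈ I)
    (hf : ∀ a b c e, a + b + c + e + 3 = 2 * q →
      (x * y * z + x * y * w + x * z * w + y * z * w) * (x ^ a * y ^ b * z ^ c * w ^ e) ∈ I)
    {a b c e : ℕ} (hab : a + b = q) (hce : c + e = q) :
    x ^ a * y ^ b * z ^ c * w ^ e ∈ I := by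
  rcases le_total a b with h1 | h1 <;> rcases le_total c e with h2 | h2
  · rcases le_total b e with h3 | h3
    · have := @cayley_monomial_mem_of_le_add R _ I q w x y z hw
        (fun e a b c h => by convert hf a b c e (by omega) using 1; ring) e a b c
        (by omega) (by omega) (by omega) (by omega)
      convert this using 1; ring
    · have := @cayley_monomial_mem_of_le_add R _ I q y x z w hy
        (fun b a c e h => by convert hf a b c e (by omega) using 1; ring) b a c e
        (by omega) (by omega) (by omega) (by omega)
      convert this using 1; ring
  · rcases le_total b c with h3 | h3
    · have := @cayley_monomial_mem_of_le_add R _ I q z x y w hz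
        (fun c a b e h => by convert hf a b c e (by omega) using 1; ring) c a b e
        (by omega) (by omega) (by omega) (by omega)
      convert this using 1; ring
    · have := @cayley_monomial_mem_of_le_add R _ I q y x z w hy
        (fun b a c e h => by convert hf a b c e (by omega) using 1; ring) b a c e
        (by omega) (by omega) (by omega) (by omega)
      convert this using 1; ring
  · rcases le_total a e with h3 | h3
    · have := @cayley_monomial_mem_of_le_add R _ I q w x y z hw
        (fun e a b c h => by convert hf a b c e (by omega) using 1; ring) e a b c
        (by omega) (by omega) (by omega) (by omega)
      convert this using 1; ring
    · exact cayley_monomial_mem_of_le_add hx hf (by omega) (by omega) (by omega) (by omega)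
  · rcases le_total a c with h3 | h3
    · have := @cayley_monomial_mem_of_le_add R _ I q z x y w hz
        (fun c a b e h => by convert hf a b c e (by omega) using 1; ring) c a b e
        (by omega) (by omega) (by omega) (by omega)
      convert this using 1; ring
    · exact cayley_monomial_mem_of_le_add hx hf (by omega) (by omega) (by omega) (by omega)

theorem cayley_monomial_mem_of_add_le {R : Type*} [CommRing R] {I : Ideal R} {q : ℕ} {x y z w : R}
    (hx : x ^ q ∈ I) (hy : y ^ q ∈ I) (hz : z ^ q ∈ I) (hw : w ^ q ∈ I)
    (hf : ∀ a b c e, a + b + c + e + 3 = 2 * q →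
      (x * y * z + x * y * w + x * z * w + y * z * w) * (x ^ a * y ^ b * z ^ c * w ^ e) ∈ I)
    {a b c e : ℕ} (hs : a + b + c + e = 2 * q) (hab : a + b ≤ q) :
    x ^ a * y ^ b * z ^ c * w ^ e ∈ I := by
  obtain ⟨r, hr⟩ : ∃ r, a + b + r = q := ⟨q - (a + b), by omega⟩
  induction r generalizing a b c e with
  | zero => exact cayley_monomial_mem_of_add_eq hx hy hz hw hf (by omega) (by omega)
  | succ r ih =>
    rcases le_or_gt q c with hcq | hcq
    · obtain ⟨c, rfl⟩ := Nat.exists_eq_add_of_le hcq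
      convert I.mul_mem_left (x ^ a * y ^ b * z ^ c * w ^ e) hz using 1
      ring
    rcases le_or_gt q e with heq | heq
    · obtain ⟨e, rfl⟩ := Nat.exists_eq_add_of_le heq
      convert I.mul_mem_left (x ^ a * y ^ b * z ^ c * w ^ e) hw using 1
      ring
    obtain ⟨c, rfl⟩ : ∃ c', c = c' + 1 := ⟨c - 1, by omega⟩
    obtain ⟨e, rfl⟩ : ∃ e', e = e' + 1 := ⟨e - 1, by omega⟩
    -- moving one factor between `x` and `y` changes the sign modulo `I`
    have shift : ∀ a b, a + b + 1 + (r + 1) = q →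
        x ^ a * y ^ (b + 1) * z ^ (c + 1) * w ^ (e + 1) +
          x ^ (a + 1) * y ^ b * z ^ (c + 1) * w ^ (e + 1) ∈ I := by
      intro a b h
      have h0 := hf a b c e (by omega)
      have h1 := @ih (a + 1) (b + 1) c (e + 1) (by omega) (by omega) (by omega)
      have h2 := @ih (a + 1) (b + 1) (c + 1) e (by omega) (by omega) (by omega)
      convert I.sub_mem (I.sub_mem h0 h1) h2 using 1
      ring
    have move : ∀ n a b, a + b + n + (r + 1) = q →
        (x ^ (a + n) * y ^ b * z ^ (c + 1) * w ^ (e + 1) ∈ I ↔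
          x ^ a * y ^ (b + n) * z ^ (c + 1) * w ^ (e + 1) ∈ I) := by
      intro n
      induction n with
      | zero => simp
      | succ n ihn =>
        intro a b h
        rw [show a + (n + 1) = a + 1 + n by ring, ihn (a + 1) b (by omega),
          show b + (n + 1) = b + n + 1 by ring]
        have := shift a (b + n) (by omega)
        exact ⟨fun h => (I.add_mem_iff_left h).1 this, fun h => (I.add_mem_iff_right h).1 this⟩
    -- after moving all of `y` to `x`, and then back, the pair `(x, z)` has exponent sum `q`
    have key : x ^ (q - (c + 1)) * y ^ (c + 1 - (r + 1)) * z ^ (c + 1) * w ^ (e + 1) ∈ I := by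
      have := @cayley_monomial_mem_of_add_eq R _ I q x z y w hx hz hy hw
        (fun a c b e h => by convert hf a b c e (by omega) using 1; ring)
        (q - (c + 1)) (c + 1) (c + 1 - (r + 1)) (e + 1) (by omega) (by omega)
      convert this using 1; ring
    have h1 := move b a 0 (by omega)
    have h2 := move (c + 1 - (r + 1)) (q - (c + 1)) 0 (by omega)
    rw [zero_add] at h1 h2
    rw [← h1, show a + b = q - (c + 1) + (c + 1 - (r + 1)) by omega, h2]
    exact key

/-- An ideal containing `x ^ q, y ^ q, z ^ q, w ^ q` and all multiples of degree `2q` of the equation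
`xyz + xyw + xzw + yzw` of Cayley's cubic surface contains all monomials of degree `2q`. -/
theorem cayley_monomial_mem {R : Type*} [CommRing R] {I : Ideal R} {q : ℕ} {x y z w : R}
    (hx : x ^ q ∈ I) (hy : y ^ q ∈ I) (hz : z ^ q ∈ I) (hw : w ^ q ∈ I)
    (hf : ∀ a b c e, a + b + c + e + 3 = 2 * q →
      (x * y * z + x * y * w + x * z * w + y * z * w) * (x ^ a * y ^ b * z ^ c * w ^ e) ∈ I)
    {a b c e : ℕ} (hs : a + b + c + e = 2 * q) :
    x ^ a * y ^ b * z ^ c * w ^ e ∈ I := by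
  rcases le_total (a + b) q with h | h
  · exact cayley_monomial_mem_of_add_le hx hy hz hw hf hs h
  · have := @cayley_monomial_mem_of_add_le R _ I q z w x y hz hw hx hy
      (fun c e a b h => by convert hf a b c e (by omega) using 1; ring) c e a b (by omega) (by omega)
    convert this using 1; ring

theorem quadric_monomial_mem_of_le_add {R : Type*} [CommRing R] {I : Ideal R} {q : ℕ} {x y z w : R}
    (hx : x ^ q ∈ I)
    (hf : ∀ a b c e, a + b + c + e + 3 = 2 * q →
      (x * y + z * w) * (x ^ a * y ^ b * z ^ c * w ^ e) ∈ I)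
    {a b c e : ℕ} (hs : a + b + c + e + 1 = 2 * q) (hc : q ≤ a + c) (he : q ≤ a + e) :
    x ^ a * y ^ b * z ^ c * w ^ e ∈ I := by
  obtain ⟨m, hm⟩ : ∃ m, q ≤ a + m := ⟨q, by omega⟩
  induction m generalizing a b c e with
  | zero =>
    obtain ⟨a, rfl⟩ := Nat.exists_eq_add_of_le hm
    convert I.mul_mem_left (x ^ a * y ^ b * z ^ c * w ^ e) hx using 1
    ring
  | succ m ih =>
    rcases le_or_gt q a with h | h
    · exact ih hs hc he (by omega)
    obtain ⟨c, rfl⟩ : ∃ c', c = c' + 1 := ⟨c - 1, by omega⟩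
    obtain ⟨e, rfl⟩ : ∃ e', e = e' + 1 := ⟨e - 1, by omega⟩
    have h1 := @ih (a + 1) (b + 1) c e (by omega) (by omega) (by omega) (by omega)
    convert I.sub_mem (hf a b c e (by omega)) h1 using 1
    ring

/-- An ideal containing `x ^ q, y ^ q, z ^ q, w ^ q` and all multiples of degree `2q - 1` of the
equation `xy + zw` of a quadric surface contains all monomials of degree `2q - 1`. -/
theorem quadric_monomial_mem {R : Type*} [CommRing R] {I : Ideal R} {q : ℕ} {x y z w : R}
    (hx : x ^ q ∈ I) (hy : y ^ q ∈ I) (hz : z ^ q ∈ I) (hw : w ^ q ∈ I)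
    (hf : ∀ a b c e, a + b + c + e + 3 = 2 * q →
      (x * y + z * w) * (x ^ a * y ^ b * z ^ c * w ^ e) ∈ I)
    {a b c e : ℕ} (hs : a + b + c + e + 1 = 2 * q) :
    x ^ a * y ^ b * z ^ c * w ^ e ∈ I := by
  have of_x : q ≤ a + c → q ≤ a + e → x ^ a * y ^ b * z ^ c * w ^ e ∈ I :=
    quadric_monomial_mem_of_le_add hx hf hs
  have of_y (h1 : q ≤ b + c) (h2 : q ≤ b + e) : x ^ a * y ^ b * z ^ c * w ^ e ∈ I := by
    have := @quadric_monomial_mem_of_le_add R _ I q y x z w hy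
      (fun b a c e h => by convert hf a b c e (by omega) using 1; ring) b a c e (by omega) h1 h2
    convert this using 1; ring
  have of_z (h1 : q ≤ c + a) (h2 : q ≤ c + b) : x ^ a * y ^ b * z ^ c * w ^ e ∈ I := by
    have := @quadric_monomial_mem_of_le_add R _ I q z w x y hz
      (fun c e a b h => by convert hf a b c e (by omega) using 1; ring) c e a b (by omega) h1 h2
    convert this using 1; ring
  have of_w (h1 : q ≤ e + a) (h2 : q ≤ e + b) : x ^ a * y ^ b * z ^ c * w ^ e ∈ I := by
    have := @quadric_monomial_mem_of_le_add R _ I q w z x y hw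
      (fun e c a b h => by convert hf a b c e (by omega) using 1; ring) e c a b (by omega) h1 h2
    convert this using 1; ring
  by_cases h1 : q ≤ a + c <;> by_cases h2 : q ≤ a + e
  · exact of_x h1 h2
  · exact of_z (by omega) (by omega)
  · exact of_w (by omega) (by omega)
  · exact of_y (by omega) (by omega)

section HilbertKunz

variable {k : Type*} [Field k]

theorem finrank_quotient_truncIdeal_succ (q n : ℕ) :
    Module.finrank k (MvPolynomial (Fin 4) k ⧸ truncIdeal k q (n + 1)) =
      Module.finrank k (MvPolynomial (Fin 4) k ⧸ truncIdeal k q n) + boxCount q n := by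
  have hn : {a : Fin 4 →₀ ℕ | a.degree = n ∧ ∀ i, a i < q}.ncard = boxCount q n := by
    rw [boxCount, ← Set.ncard_coe_finset]
    refine Set.ncard_congr (fun a _ => (a 0, a 1, a 2, a 3)) ?_ ?_ ?_
    · rintro a ⟨ha, hq⟩
      rw [Finsupp.degree_eq_sum, Fin.sum_univ_four] at ha
      simp [ha, hq]
    · intro a b _ _ h
      simp only [Prod.mk.injEq] at h
      ext i
      fin_cases i
      exacts [h.1, h.2.1, h.2.2.1, h.2.2.2]
    · rintro ⟨a, b, c, e⟩ h
      refine ⟨Finsupp.equivFunOnFinite.symm ![a, b, c, e], ?_, by simp⟩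
      simpa [Finsupp.degree_eq_sum, Fin.sum_univ_four, Fin.forall_fin_succ, and_comm] using h
  have hunion : (truncExponents q (n + 1))ᶜ =
      (truncExponents q n)ᶜ ∪ {a | a.degree = n ∧ ∀ i, a i < q} := by
    ext a
    simp only [truncExponents, Set.mem_compl_iff, Set.mem_ofPred_eq, not_or, not_exists, not_le,
      Set.mem_union, ← or_and_right]
    rw [Nat.lt_succ_iff_lt_or_eq]
  have hdisj : Disjoint (truncExponents q n)ᶜ {a | a.degree = n ∧ ∀ i, a i < q} :=
    Set.disjoint_left.2 fun a ha h => ha (Or.inl h.1.ge)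
  have hfin := finite_compl_truncExponents q (n + 1)
  rw [truncIdeal, truncIdeal, finrank_quotient_restrictSupportIdeal _ hfin,
    finrank_quotient_restrictSupportIdeal _ (finite_compl_truncExponents q n), ← hn, hunion,
    Set.ncard_union_eq hdisj (finite_compl_truncExponents q n)
      (hfin.subset (hunion ▸ Set.subset_union_right))]

/-- A lower bound for the Hilbert-Kunz function of a form of degree `d`. -/
theorem mul_boxCount_le_finrank_quotient {f : MvPolynomial (Fin 4) k} {d q : ℕ}
    (hf : f.IsHomogeneous d) (hd : 2 ≤ d) (hq : d ≤ q) :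
    d * boxCount q (2 * q - 2) ≤
      Module.finrank k (MvPolynomial (Fin 4) k ⧸ (Ideal.span {f} ⊔ powIdeal k q)) +
        d * d * q ^ 2 := by
  have hstep : ∀ i ≤ d,
      Module.finrank k (MvPolynomial (Fin 4) k ⧸ truncIdeal k q (2 * q - d)) +
        i * boxCount q (2 * q - 2) ≤
      Module.finrank k (MvPolynomial (Fin 4) k ⧸ truncIdeal k q (2 * q - d + i)) +
        i * (d * q ^ 2) := by
    intro i hi
    induction i with
    | zero => simp
    | succ i ih =>
      have hbox : boxCount q (2 * q - 2) ≤ boxCount q (2 * q - d + i) + d * q ^ 2 := by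
        rcases le_total (i + 2) d with h | h
        · have := boxCount_add_le q (2 * q - d + i) (d - 2 - i)
          rw [show 2 * q - d + i + (d - 2 - i) = 2 * q - 2 by omega] at this
          refine this.trans ?_
          gcongr
          omega
        · have := boxCount_le_add q (2 * q - 2) (i + 2 - d)
          rw [show 2 * q - 2 + (i + 2 - d) = 2 * q - d + i by omega] at this
          refine this.trans ?_
          gcongr
          omega
      rw [← add_assoc, finrank_quotient_truncIdeal_succ]
      linarith [ih (by omega)]
  have h1 := hstep d le_rfl
  rw [show 2 * q - d + d = 2 * q by omega] at h1
  linarith [finrank_quotient_truncIdeal_le hf q (2 * q)]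

theorem monomial_fin_four {R : Type*} [CommSemiring R] (a : Fin 4 →₀ ℕ) :
    monomial a (1 : R) = X 0 ^ a 0 * X 1 ^ a 1 * X 2 ^ a 2 * X 3 ^ a 3 := by
  rw [monomial_eq, Finsupp.prod_fintype _ _ (by simp), Fin.prod_univ_four, C_1, one_mul]

theorem mul_X_pow_mem_of_forall_degree {R : Type*} [CommSemiring R] {f : MvPolynomial (Fin 4) R}
    {I : Ideal (MvPolynomial (Fin 4) R)} {n d : ℕ}
    (h : ∀ b : Fin 4 →₀ ℕ, b.degree + d = n → f * monomial b 1 ∈ I) (a b c e : ℕ)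
    (hs : a + b + c + e + d = n) : f * (X 0 ^ a * X 1 ^ b * X 2 ^ c * X 3 ^ e) ∈ I := by
  have := h (Finsupp.equivFunOnFinite.symm ![a, b, c, e])
    (by simpa [Finsupp.degree_eq_sum, Fin.sum_univ_four] using hs)
  simpa [monomial_fin_four] using this

/-- The equation of a smooth quadric surface. -/
noncomputable def quadric (k : Type*) [Field k] : MvPolynomial (Fin 4) k :=
  X 0 * X 1 + X 2 * X 3

/-- The equation of Cayley's nodal cubic surface. -/
noncomputable def cayleyCubic (k : Type*) [Field k] : MvPolynomial (Fin 4) k :=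
  X 0 * X 1 * X 2 + X 0 * X 1 * X 3 + X 0 * X 2 * X 3 + X 1 * X 2 * X 3

theorem isHomogeneous_quadric : (quadric k).IsHomogeneous 2 :=
  ((isHomogeneous_X k _).mul (isHomogeneous_X k _)).add
    ((isHomogeneous_X k _).mul (isHomogeneous_X k _))

theorem isHomogeneous_cayleyCubic : (cayleyCubic k).IsHomogeneous 3 := by
  have h (i j l : Fin 4) : (X i * X j * X l : MvPolynomial (Fin 4) k).IsHomogeneous 3 :=
    ((isHomogeneous_X k i).mul (isHomogeneous_X k j)).mul (isHomogeneous_X k l)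
  exact (((h _ _ _).add (h _ _ _)).add (h _ _ _)).add (h _ _ _)

theorem quadric_ne_zero : quadric k ≠ 0 := fun h => by
  simpa [quadric] using congrArg (eval ![(1 : k), 1, 0, 0]) h

theorem cayleyCubic_ne_zero : cayleyCubic k ≠ 0 := fun h => by
  simpa [cayleyCubic] using congrArg (eval ![(1 : k), 1, 1, 0]) h

theorem finrank_quotient_quadric_le {q : ℕ} (hq : 2 ≤ q) :
    Module.finrank k (MvPolynomial (Fin 4) k ⧸ (Ideal.span {quadric k} ⊔ powIdeal k q)) ≤
      2 * boxCount q (2 * q - 2) + q ^ 2 := by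
  have h := finrank_quotient_truncIdeal_eq (q := q) (n := 2 * q - 1)
    (isHomogeneous_quadric (k := k)) (by omega) (by omega) fun I hX hI a ha => by
      rw [Finsupp.degree_eq_sum, Fin.sum_univ_four] at ha
      rw [monomial_fin_four]
      exact quadric_monomial_mem (hX 0) (hX 1) (hX 2) (hX 3)
        (fun a b c e hs => mul_X_pow_mem_of_forall_degree hI a b c e (by omega)) (by omega)
  obtain ⟨j, hj⟩ : ∃ j, 2 * q = j + 3 := ⟨2 * q - 3, by omega⟩
  have := boxCount_le_succ q j
  rw [show 2 * q - 1 = j + 1 + 1 by omega, show j + 1 + 1 - 2 = j by omega,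
    finrank_quotient_truncIdeal_succ, finrank_quotient_truncIdeal_succ] at h
  rw [show 2 * q - 2 = j + 1 by omega]
  omega

theorem finrank_quotient_cayleyCubic_le {q : ℕ} (hq : 2 ≤ q) :
    Module.finrank k (MvPolynomial (Fin 4) k ⧸ (Ideal.span {cayleyCubic k} ⊔ powIdeal k q)) ≤
      3 * boxCount q (2 * q - 2) + 2 * q ^ 2 := by
  have h := finrank_quotient_truncIdeal_eq (q := q) (n := 2 * q)
    (isHomogeneous_cayleyCubic (k := k)) (by omega) (by omega) fun I hX hI a ha => by
      rw [Finsupp.degree_eq_sum, Fin.sum_univ_four] at ha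
      rw [monomial_fin_four]
      exact cayley_monomial_mem (hX 0) (hX 1) (hX 2) (hX 3)
        (fun a b c e hs => mul_X_pow_mem_of_forall_degree hI a b c e (by omega)) (by omega)
  obtain ⟨j, hj⟩ : ∃ j, 2 * q = j + 3 := ⟨2 * q - 3, by omega⟩
  have h1 := boxCount_le_succ q j
  have h2 : boxCount q (j + 2) ≤ boxCount q (j + 1) + q ^ 2 := boxCount_succ_le q (j + 1)
  rw [hj, Nat.add_sub_cancel, finrank_quotient_truncIdeal_succ, finrank_quotient_truncIdeal_succ,
    finrank_quotient_truncIdeal_succ] at h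
  rw [show 2 * q - 2 = j + 1 by omega]
  omega

/-- In each degree `d ≥ 2` there is a form whose Hilbert-Kunz function is at most
`2 * d * q ^ 3 / 3 + O(q ^ 2)`. -/
theorem exists_isHomogeneous_finrank_quotient_le (k : Type*) [Field k] {d : ℕ} (hd : 2 ≤ d) :
    ∃ f : MvPolynomial (Fin 4) k, f ≠ 0 ∧ f.IsHomogeneous d ∧ ∀ q, 2 ≤ q →
      Module.finrank k (MvPolynomial (Fin 4) k ⧸ (Ideal.span {f} ⊔ powIdeal k q)) ≤
        d * boxCount q (2 * q - 2) + d * q ^ 2 := by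
  rcases Nat.even_or_odd' d with ⟨m, rfl | rfl⟩
  · refine ⟨quadric k ^ m, pow_ne_zero _ quadric_ne_zero, isHomogeneous_quadric.pow m,
      fun q hq => (Ideal.finrank_quotient_pow_sup_le _ _ m).trans ?_⟩
    have := Nat.mul_le_mul_left m (finrank_quotient_quadric_le (k := k) hq)
    nlinarith [Nat.zero_le (m * q ^ 2)]
  · obtain ⟨m, rfl⟩ : ∃ n, m = n + 1 := ⟨m - 1, by omega⟩
    refine ⟨quadric k ^ m * cayleyCubic k,
      mul_ne_zero (pow_ne_zero _ quadric_ne_zero) cayleyCubic_ne_zero,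
      (isHomogeneous_quadric.pow m).mul isHomogeneous_cayleyCubic,
      fun q hq => (Ideal.finrank_quotient_mul_sup_le _ _ _).trans ?_⟩
    have h1 := Ideal.finrank_quotient_pow_sup_le (k := k) (quadric k) (powIdeal k q) m
    have h2 := Nat.mul_le_mul_left m (finrank_quotient_quadric_le (k := k) hq)
    have h3 := finrank_quotient_cayleyCubic_le (k := k) hq
    nlinarith [Nat.zero_le (m * q ^ 2)]

theorem span_insert_X_pow_eq (f : MvPolynomial (Fin 4) k) (q : ℕ) :
    Ideal.span {f, X 0 ^ q, X 1 ^ q, X 2 ^ q, X 3 ^ q} = Ideal.span {f} ⊔ powIdeal k q :=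
  Ideal.span_insert _ _

end HilbertKunz

/-- **Minimal Hilbert-Kunz multiplicity of surfaces in P³.**
For any field `k` of prime characteristic `p` and any degree `d ≥ 2`, there is a nonzero
homogeneous `f ∈ k[x,y,z,w]` of degree `d` whose Hilbert-Kunz multiplicity
`lim_n dim_k k[x,y,z,w]/(f, x^{pⁿ}, y^{pⁿ}, z^{pⁿ}, w^{pⁿ}) / p^{3n}` equals `2d/3`. -/
theorem exists_surface_minimal_hilbert_kunz_multiplicity
    (k : Type*) [Field k] (p : ℕ) [Fact p.Prime] [CharP k p] (d : ℕ) (hd : 2 ≤ d) :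
    ∃ f : MvPolynomial (Fin 4) k, f ≠ 0 ∧ f.IsHomogeneous d ∧
      Filter.Tendsto
        (fun n : ℕ =>
          (Module.finrank k (MvPolynomial (Fin 4) k ⧸
              Ideal.span {f, X 0 ^ p ^ n, X 1 ^ p ^ n, X 2 ^ p ^ n, X 3 ^ p ^ n}) : ℝ) /
            (p : ℝ) ^ (3 * n))
        Filter.atTop (nhds (2 * d / 3)) := by
  obtain ⟨f, hf0, hf, hle⟩ := exists_isHomogeneous_finrank_quotient_le k hd
  refine ⟨f, hf0, hf, ?_⟩
  have hp : 1 < p := (Fact.out : p.Prime).one_lt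
  have hlim : Filter.Tendsto (fun n : ℕ => 2 * (d : ℝ) ^ 2 / (p : ℝ) ^ n) Filter.atTop (nhds 0) :=
    (tendsto_pow_atTop_atTop_of_one_lt (by exact_mod_cast hp)).const_div_atTop _
  rw [tendsto_iff_dist_tendsto_zero]
  refine squeeze_zero' (Filter.Eventually.of_forall fun _ => dist_nonneg) ?_ hlim
  filter_upwards [(tendsto_pow_atTop_atTop_of_one_lt hp).eventually_ge_atTop d] with n hn
  rw [span_insert_X_pow_eq, mul_comm 3 n, pow_mul, ← Nat.cast_pow]
  generalize p ^ n = q at hn ⊢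
  have hlower := mul_boxCount_le_finrank_quotient hf hd hn
  have hupper := hle q (hd.trans hn)
  have hcentral := three_mul_boxCount_central (q := q) (by omega)
  generalize Module.finrank k (MvPolynomial (Fin 4) k ⧸ (Ideal.span {f} ⊔ powIdeal k q)) = N
    at hlower hupper
  generalize boxCount q (2 * q - 2) = t at hlower hupper hcentral
  have hq : (2 : ℝ) ≤ q := by exact_mod_cast hd.trans hn
  have hd' : (2 : ℝ) ≤ d := by exact_mod_cast hd
  replace hlower : (d * t : ℝ) ≤ N + d * d * q ^ 2 := by exact_mod_cast hlower
  replace hupper : (N : ℝ) ≤ d * t + d * q ^ 2 := by exact_mod_cast hupper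
  replace hcentral : (3 * t : ℝ) = 2 * q ^ 3 + q := by exact_mod_cast hcentral
  have ht : (t : ℝ) = (2 * q ^ 3 + q) / 3 := by linarith
  rw [ht] at hlower hupper
  rw [Real.dist_eq, show (N : ℝ) / q ^ 3 - 2 * d / 3 = (N - 2 * d / 3 * q ^ 3) / q ^ 3 by field_simp,
    show 2 * (d : ℝ) ^ 2 / q = 2 * d ^ 2 * q ^ 2 / q ^ 3 by field_simp, abs_div,
    abs_of_pos (by positivity : (0 : ℝ) < q ^ 3)]
  gcongr
  have hdq : (d : ℝ) * q ≤ d * q ^ 2 := by gcongr; nlinarith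
  have hdd : (d : ℝ) * q ^ 2 ≤ d ^ 2 * q ^ 2 := by gcongr; nlinarith
  rw [abs_le]
  constructor <;> nlinarith
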